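/- For every idempotent e of a semigroup X, the polyboundedness numbers of X and of the subsemigroup eXe = {exe : x ∈ X} coincide: cov(A_X) = cov(A_{eXe}). -/

import Mathlib

open Cardinal Pointwise

universe u

namespace ZeroClosedPaper

/-- The value of the semigroup polynomial with coefficient list `a = [a₀, a₁, …, aₙ]`
(coefficients in `X¹ = WithOne X`) at the point `x`, i.e. `a₀xa₁x⋯xaₙ`,
computed in the monoid `WithOne X`. Its degree (the number of occurrences of `x`)
is `a.length - 1`. -/
def polyVal {X : Type*} [Semigroup X] (a : List (WithOne X)) (x : X) : WithOne X :=
  match a with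
  | [] => 1
  | a₀ :: rest => a₀ * (rest.map (fun ai => (x : WithOne X) * ai)).prod

/-- A subset `A` of a semigroup `X` is algebraic if
`A = {x ∈ X : a₀xa₁⋯xaₙ = b}` for some `n ≥ 1`, `b ∈ X` and `a₀,…,aₙ ∈ X¹`. -/
def IsAlgebraicSet {X : Type*} [Semigroup X] (A : Set X) : Prop :=
  ∃ (a : List (WithOne X)) (b : X), 2 ≤ a.length ∧
    A = {x : X | polyVal a x = (b : WithOne X)}

/-- The polyboundedness number `cov(A_X)`: the smallest cardinality of a cover of `X`
by algebraic subsets of `X`. -/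
noncomputable def covA (X : Type*) [Semigroup X] : Cardinal :=
  sInf {c : Cardinal | ∃ C : Set (Set X), (∀ A ∈ C, IsAlgebraicSet A) ∧
    ⋃₀ C = Set.univ ∧ Cardinal.mk ↥C = c}

/-- A subset `S` of a semigroup `X` is polybounded in `X` if it can be covered by
finitely many algebraic subsets of `X`. -/
def PolyboundedIn {X : Type*} [Semigroup X] (S : Set X) : Prop :=
  ∃ C : Set (Set X), C.Finite ∧ (∀ A ∈ C, IsAlgebraicSet A) ∧ S ⊆ ⋃₀ C

/-- A semigroup is polybounded if it admits a finite cover by algebraic sets. -/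
def Polybounded (X : Type*) [Semigroup X] : Prop :=
  PolyboundedIn (Set.univ : Set X)

/-- A semigroup `X` is polyfinite if there are `n ∈ ℕ` and a finite `F ⊆ X` such that
for all `x, y ∈ X` some semigroup polynomial `f` of degree `≤ n` has `f(x), f(y) ∈ F`. -/
def Polyfinite (X : Type*) [Semigroup X] : Prop :=
  ∃ (n : ℕ) (F : Set X), F.Finite ∧ ∀ x y : X, ∃ a : List (WithOne X),
    2 ≤ a.length ∧ a.length ≤ n + 1 ∧
    (∃ u ∈ F, polyVal a x = (u : WithOne X)) ∧
    (∃ v ∈ F, polyVal a y = (v : WithOne X))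

/-- A semigroup `X` is zero-closed if `X` is closed in its `0`-extension
`X⁰ = WithZero X` endowed with any Hausdorff semigroup topology. -/
def ZeroClosed (X : Type*) [Semigroup X] : Prop :=
  ∀ τ : TopologicalSpace (WithZero X),
    @T2Space (WithZero X) τ → @ContinuousMul (WithZero X) τ _ →
    @IsClosed (WithZero X) τ (Set.range ((↑) : X → WithZero X))

/-- `d` is a pseudometric. -/
def IsPseudometric {X : Type*} (d : X → X → ℝ) : Prop :=
  (∀ x, d x x = 0) ∧ (∀ x y, d x y = d y x) ∧ (∀ x y z, d x z ≤ d x y + d y z)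

/-- `d` is subinvariant: `d(axb, ayb) ≤ d(x,y)` for all `a, b ∈ X¹`
(equivalently, `d` is both left- and right-nonexpansive under translations). -/
def Subinvariant {X : Type*} [Semigroup X] (d : X → X → ℝ) : Prop :=
  (∀ a x y : X, d (a * x) (a * y) ≤ d x y) ∧
  (∀ b x y : X, d (x * b) (y * b) ≤ d x y)

/-- `d` is separable: some countable set is `d`-dense. -/
def SeparablePseudometric {X : Type*} (d : X → X → ℝ) : Prop :=
  ∃ C : Set X, C.Countable ∧ ∀ x : X, ∀ ε : ℝ, 0 < ε → ∃ c ∈ C, d x c < ε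

/-- `cov(M)`: the smallest cardinality of a cover of the real line by meager sets. -/
noncomputable def covMeager : Cardinal :=
  sInf {c : Cardinal | ∃ S : Set (Set ℝ), (∀ A ∈ S, IsMeagre A) ∧
    ⋃₀ S = Set.univ ∧ Cardinal.mk ↥S = c}

/-- `cov(N̄)`: the smallest cardinality of a cover of the real line by closed
Lebesgue-null sets. -/
noncomputable def covClosedNull : Cardinal :=
  sInf {c : Cardinal | ∃ S : Set (Set ℝ),
    (∀ A ∈ S, IsClosed A ∧ MeasureTheory.volume A = 0) ∧
    ⋃₀ S = Set.univ ∧ Cardinal.mk ↥S = c}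

/-- A topological space is power-Lindelöf if each finite power is Lindelöf. -/
def PowerLindelof (Y : Type*) [TopologicalSpace Y] : Prop :=
  ∀ n : ℕ, LindelofSpace (Fin n → Y)

/-- `I` is an ideal of the semigroup `X`. -/
def IsIdeal {X : Type*} [Semigroup X] (I : Set X) : Prop :=
  ∀ x ∈ I, ∀ a : X, x * a ∈ I ∧ a * x ∈ I

theorem polyVal_cons_cons {X : Type*} [Semigroup X] (a b : WithOne X) (l : List (WithOne X))
    (x : X) : polyVal (a :: b :: l) x = a * (x * polyVal (b :: l) x) := by
  simp [polyVal, mul_assoc]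

/-- Sandwiching all coefficients by `e` amounts to sandwiching both the argument
and the value. -/
theorem polyVal_map_sandwich {X : Type*} [Semigroup X] (e x : X)
    (a : WithOne X) (l : List (WithOne X)) :
    polyVal ((a :: l).map fun c => (e : WithOne X) * c * (e : WithOne X)) x =
      (e : WithOne X) * polyVal (a :: l) (e * x * e) * (e : WithOne X) := by
  induction l generalizing a with
  | nil => simp [polyVal]
  | cons b l ih =>
    have h := ih b
    rw [List.map_cons] at h
    rw [List.map_cons, List.map_cons, polyVal_cons_cons, polyVal_cons_cons, h]
    simp only [WithOne.coe_mul, mul_assoc]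

theorem map_polyVal {X Y : Type*} [Semigroup X] [Semigroup Y] (f : X →ₙ* Y)
    (l : List (WithOne X)) (x : X) :
    WithOne.mapMulHom f (polyVal l x) = polyVal (l.map (WithOne.mapMulHom f)) (f x) := by
  cases l with
  | nil => simp [polyVal]
  | cons a l =>
    induction l generalizing a with
    | nil => simp [polyVal]
    | cons b l ih =>
      have h := ih b
      rw [List.map_cons] at h
      rw [List.map_cons, List.map_cons, polyVal_cons_cons, polyVal_cons_cons, map_mul, map_mul, h,
        WithOne.mapMulHom_coe]

theorem isAlgebraicSet_singleton {X : Type*} [Semigroup X] (x : X) :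
    IsAlgebraicSet ({x} : Set X) :=
  ⟨[1, 1], x, le_rfl, by ext y; simp [polyVal]⟩

theorem covA_le_of_preimage_subset {X Y : Type u} [Semigroup X] [Semigroup Y] (f : Y → X)
    (hf : ∀ A : Set X, IsAlgebraicSet A → ∃ B : Set Y, IsAlgebraicSet B ∧ f ⁻¹' A ⊆ B) :
    covA Y ≤ covA X := by
  have hne : {c : Cardinal | ∃ C : Set (Set X), (∀ A ∈ C, IsAlgebraicSet A) ∧
      ⋃₀ C = Set.univ ∧ Cardinal.mk ↥C = c}.Nonempty := by
    refine ⟨_, Set.range fun x : X => ({x} : Set X), ?_, ?_, rfl⟩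
    · rintro _ ⟨x, rfl⟩
      exact isAlgebraicSet_singleton x
    · exact Set.eq_univ_of_forall fun x => ⟨{x}, ⟨x, rfl⟩, rfl⟩
  obtain ⟨C, hC, hcov, hcard⟩ := csInf_mem hne
  choose! g hg hsub using hf
  have hle : covA Y ≤ Cardinal.mk ↥(g '' C) := by
    refine csInf_le' ⟨g '' C, ?_, ?_, rfl⟩
    · rintro _ ⟨A, hA, rfl⟩
      exact hg A (hC A hA)
    · refine Set.eq_univ_of_forall fun y => ?_
      obtain ⟨A, hA, hy⟩ : f y ∈ ⋃₀ C := hcov ▸ Set.mem_univ _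
      exact ⟨g A, ⟨A, hA, rfl⟩, hsub A (hC A hA) hy⟩
  exact (hle.trans Cardinal.mk_image_le).trans hcard.le

/-- For every idempotent `e` of a semigroup `X`,
`cov(A_X) = cov(A_{eXe})`. -/
theorem statement11 {X : Type u} [Semigroup X] (e : X) (he : e * e = e)
    (S : Subsemigroup X) (hS : (S : Set X) = {z : X | ∃ x : X, e * x * e = z}) :
    covA X = covA ↥S := by
  have mem (x : X) : e * x * e ∈ S := by
    rw [← SetLike.mem_coe, hS]
    exact ⟨x, rfl⟩
  have fixed {y : X} (hy : y ∈ S) : e * y * e = y := by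
    rw [← SetLike.mem_coe, hS] at hy
    obtain ⟨x, rfl⟩ := hy
    simp only [mul_assoc, he]
    simp only [← mul_assoc, he]
  let ι : WithOne S →* WithOne X := WithOne.mapMulHom (MulMemClass.subtype S)
  have hι (s : S) : ι s = ((s : X) : WithOne X) := WithOne.mapMulHom_coe _ _
  apply le_antisymm
  · refine covA_le_of_preimage_subset (fun x => ⟨e * x * e, mem x⟩) ?_
    rintro _ ⟨l, b, hl, rfl⟩
    refine ⟨_, ⟨(l.map ι).map fun c => (e : WithOne X) * c * (e : WithOne X), b, by simpa using hl, rfl⟩, ?_⟩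
    intro x hx
    obtain ⟨a, l, rfl⟩ := List.exists_cons_of_length_pos (by omega : 0 < l.length)
    have h := congrArg ι hx
    rw [map_polyVal, hι] at h
    change polyVal (List.map ι (a :: l)) (e * x * e) = _ at h
    rw [List.map_cons] at h
    change polyVal _ x = _
    rw [List.map_cons (f := ι), polyVal_map_sandwich, h, ← WithOne.coe_mul, ← WithOne.coe_mul,
      fixed b.2]
  · refine covA_le_of_preimage_subset (Subtype.val : S → X) ?_
    have hlift (c : WithOne X) : ∃ s : WithOne S, ι s = (e : WithOne X) * c * (e : WithOne X) := by
      induction c using WithOne.recOneCoe with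
      | one => exact ⟨(⟨e * e * e, mem e⟩ : S), by simp [hι, he, ← WithOne.coe_mul]⟩
      | coe x => exact ⟨(⟨e * x * e, mem x⟩ : S), by simp [hι]⟩
    choose g hg using hlift
    have hinj : Function.Injective ι := by
      intro s t hst
      induction s using WithOne.recOneCoe <;> induction t using WithOne.recOneCoe
      · rfl
      · rw [map_one, hι] at hst
        exact absurd hst.symm WithOne.coe_ne_one
      · rw [map_one, hι] at hst
        exact absurd hst WithOne.coe_ne_one
      · rw [hι, hι, WithOne.coe_inj] at hst
        rw [Subtype.ext hst]
    rintro _ ⟨l, b, hl, rfl⟩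
    refine ⟨_, ⟨l.map g, ⟨e * b * e, mem b⟩, by simpa using hl, rfl⟩, ?_⟩
    intro x hx
    obtain ⟨a, l, rfl⟩ := List.exists_cons_of_length_pos (by omega : 0 < l.length)
    apply hinj
    rw [map_polyVal, hι, List.map_map]
    change polyVal (List.map (fun c => ι (g c)) (a :: l)) (x : X) = _
    simp only [hg]
    rw [polyVal_map_sandwich, fixed x.2, WithOne.coe_mul, WithOne.coe_mul]
    exact congrArg (fun w => (e : WithOne X) * w * (e : WithOne X)) hx

end ZeroClosedPaper
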